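/- Let N ≥ 3, let i, j ∈ ℕ, set σ_i = (N−2)/2 + i, and let Y : ℝ^N → ℝ be a harmonic polynomial that is homogeneous of degree i (ΔY = 0). Define Φ(x) = (1+|x|²)^{−(N−2)/2 − i} · P_j^{(σ_i,σ_i)}(1 − 2/(1+|x|²)) · Y(x) and λ_{i,j} = 1 − N(N+2)/(((N+1) + 2(i+j−1))² − 1). Then Φ is smooth and satisfies (1 − λ_{i,j}) (−ΔΦ)(x) = N(N+2)(1+|x|²)^{−2} Φ(x) for all x ∈ ℝ^N; equivalently, Φ is an eigenfunction with eigenvalue λ_{i,j} of the problem −Δu − (N+2)/(N−2) z_{1,0}^{4/(N−2)} u = λ(−Δu), where z_{1,0}(x) = (N(N−2))^{(N−2)/4}(1+|x|²)^{−(N−2)/2}. -/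

import Mathlib

open MeasureTheory

/-- The Euclidean Laplacian: sum of second partial derivatives. -/
noncomputable def lap {N : ℕ} (u : EuclideanSpace ℝ (Fin N) → ℝ)
    (x : EuclideanSpace ℝ (Fin N)) : ℝ :=
  ∑ i : Fin N,
    fderiv ℝ (fun z => fderiv ℝ u z (EuclideanSpace.single i 1)) x (EuclideanSpace.single i 1)

open Polynomial in
/-- The polynomial `q` with `(d/dt)^n (1 - t ^ 2) ^ a = q(t) (1 - t ^ 2) ^ (a - n)`. -/
noncomputable def rodriguesPoly (a : ℝ) : ℕ → Polynomial ℝ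
  | 0 => 1
  | n + 1 => (1 - X ^ 2) * derivative (rodriguesPoly a n) - C (2 * (a - n)) * X * rodriguesPoly a n

open Polynomial in
theorem rodriguesPoly_ode (a : ℝ) (n : ℕ) :
    (1 - X ^ 2) * derivative (derivative (rodriguesPoly a n))
      - C (2 * (a - n + 1)) * X * derivative (rodriguesPoly a n)
      + C (n * (2 * a - n + 1)) * rodriguesPoly a n = 0 := by
  induction n with
  | zero => simp [rodriguesPoly]
  | succ n ih =>
    have h : derivative (rodriguesPoly a (n + 1)) =
        -(C ((n + 1) * (2 * a - n)) * rodriguesPoly a n) := by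
      simp only [rodriguesPoly, derivative_sub, derivative_mul, derivative_one, derivative_X_pow,
        derivative_C, derivative_X]
      simp only [map_mul, map_sub, map_add, map_natCast, map_one, map_ofNat, Nat.cast_ofNat,
        Nat.add_one_sub_one] at ih ⊢
      linear_combination ih
    rw [h]
    simp only [derivative_neg, derivative_mul, derivative_C, rodriguesPoly]
    simp only [map_mul, map_sub, map_add, map_natCast, map_one, map_ofNat, Nat.cast_add,
      Nat.cast_one]
    ring

theorem iteratedDeriv_one_sub_sq_rpow (a : ℝ) (n : ℕ) {t : ℝ} (ht : t ∈ Set.Ioo (-1 : ℝ) 1) :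
    iteratedDeriv n (fun s : ℝ => (1 - s ^ 2) ^ a) t =
      (rodriguesPoly a n).eval t * (1 - t ^ 2) ^ (a - n) := by
  induction n generalizing t with
  | zero => simp [rodriguesPoly]
  | succ n ih =>
    have hpos : 0 < 1 - t ^ 2 := by nlinarith [ht.1, ht.2]
    have heq : iteratedDeriv n (fun s : ℝ => (1 - s ^ 2) ^ a) =ᶠ[nhds t]
        fun s => (rodriguesPoly a n).eval s * (1 - s ^ 2) ^ (a - n) :=
      Filter.eventuallyEq_of_mem (isOpen_Ioo.mem_nhds ht) fun s hs => ih hs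
    have hbase : HasDerivAt (fun s : ℝ => 1 - s ^ 2) (-(2 * t)) t := by
      simpa using (hasDerivAt_pow 2 t).const_sub 1
    have hd := ((rodriguesPoly a n).hasDerivAt t).mul
      (hbase.rpow_const (p := a - n) (Or.inl hpos.ne'))
    rw [iteratedDeriv_succ, heq.deriv_eq]
    refine hd.deriv.trans ?_
    have hs : (1 - t ^ 2) ^ (a - n) = (1 - t ^ 2) * (1 - t ^ 2) ^ (a - n - 1) := by
      rw [Real.rpow_sub_one hpos.ne']; field_simp
    have hc : a - ((n + 1 : ℕ) : ℝ) = a - n - 1 := by push_cast; ring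
    rw [hc, hs]
    simp [rodriguesPoly]
    ring

open Polynomial in
/-- The Jacobi differential equation, for a polynomial given by the Rodrigues formula. -/
theorem jacobi_ode {σ : ℝ} {j : ℕ} {c : ℝ} {p : Polynomial ℝ}
    (hp : ∀ t ∈ Set.Ioo (-1 : ℝ) 1, p.eval t = c * (1 - t ^ 2) ^ (-σ) *
        iteratedDeriv j (fun s : ℝ => (1 - s ^ 2) ^ (σ + (j : ℝ))) t) (t : ℝ) :
    (1 - t ^ 2) * (derivative (derivative p)).eval t - 2 * (σ + 1) * t * (derivative p).eval t
      + j * (j + 2 * σ + 1) * p.eval t = 0 := by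
  have h : p = C c * rodriguesPoly (σ + j) j := by
    refine eq_of_infinite_eval_eq _ _ ((Set.Ioo_infinite (by norm_num : (-1 : ℝ) < 1)).mono ?_)
    intro t ht
    have hpos : 0 < 1 - t ^ 2 := by nlinarith [ht.1, ht.2]
    have hm : (1 - t ^ 2) ^ (-σ) * (1 - t ^ 2) ^ σ = 1 := by
      rw [← Real.rpow_add hpos]; simp
    simp only [Set.mem_ofPred_eq, hp t ht, iteratedDeriv_one_sub_sq_rpow _ _ ht,
      add_sub_cancel_right, eval_mul, eval_C]
    linear_combination c * eval t (rodriguesPoly (σ + j) j) * hm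
  have := congrArg (eval t) (rodriguesPoly_ode (σ + j) j)
  simp only [eval_add, eval_sub, eval_mul, eval_C, eval_X, eval_pow, eval_one, eval_zero] at this
  simp only [h, derivative_mul, derivative_C, zero_mul, zero_add, eval_mul, eval_C]
  linear_combination c * this

theorem contDiff_eval_mvPolynomial {N : ℕ} (q : MvPolynomial (Fin N) ℝ) :
    ContDiff ℝ (⊤ : ℕ∞)
      (fun x : EuclideanSpace ℝ (Fin N) => MvPolynomial.eval (fun l => x l) q) := by
  induction q using MvPolynomial.induction_on with
  | C a => simpa using contDiff_const
  | add p q hp hq => simpa using hp.add hq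
  | mul_X p l hp =>
    simp only [map_mul, MvPolynomial.eval_X]
    exact hp.mul (by fun_prop)

theorem MvPolynomial.IsHomogeneous.eval_smul {ι R : Type*} [Fintype ι] [CommSemiring R]
    {q : MvPolynomial ι R} {i : ℕ} (hq : q.IsHomogeneous i) (t : R) (x : ι → R) :
    eval (t • x) q = t ^ i * eval x q := by
  rw [eval_eq', eval_eq', Finset.mul_sum]
  refine Finset.sum_congr rfl fun d hd => ?_
  have h : ∑ l, d l = i :=
    (Finsupp.degree_eq_sum d).symm.trans
      ((DFunLike.congr_fun Finsupp.degree_eq_weight_one d).trans (hq (mem_support_iff.mp hd)))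
  simp only [Pi.smul_apply, smul_eq_mul, mul_pow,
    Finset.prod_mul_distrib, Finset.prod_pow_eq_pow_sum, h]
  ring

theorem EuclideanSpace.sum_mul_apply_single {N : ℕ} (L : EuclideanSpace ℝ (Fin N) →L[ℝ] ℝ)
    (x : EuclideanSpace ℝ (Fin N)) :
    ∑ l, x l * L (EuclideanSpace.single l 1) = L x := by
  have h := (EuclideanSpace.basisFun (Fin N) ℝ).sum_repr x
  conv_rhs => rw [← h]
  simp

/-- Euler's identity for homogeneous functions. -/
theorem fderiv_apply_self_of_homogeneous {E : Type*} [NormedAddCommGroup E] [NormedSpace ℝ E]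
    {Y : E → ℝ} {i : ℕ} {x : E} (hd : DifferentiableAt ℝ Y x)
    (hY : ∀ t : ℝ, Y (t • x) = t ^ i * Y x) : fderiv ℝ Y x x = i * Y x := by
  have h1 : HasDerivAt (fun t : ℝ => t • x) x 1 := by
    simpa using (hasDerivAt_id (1 : ℝ)).smul_const x
  have h2 : HasDerivAt (fun t : ℝ => Y (t • x)) (fderiv ℝ Y x x) 1 :=
    HasFDerivAt.comp_hasDerivAt (1 : ℝ) (by simpa using hd.hasFDerivAt) h1
  have h3 : HasDerivAt (fun t : ℝ => Y (t • x)) (i * Y x) 1 := by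
    simp only [hY]
    simpa using (hasDerivAt_pow i (1 : ℝ)).mul_const (Y x)
  exact h2.unique h3

/-- The Laplacian of the product of a radial function and a homogeneous harmonic function. -/
theorem lap_radial_mul {N i : ℕ} {Y Φ : EuclideanSpace ℝ (Fin N) → ℝ} (hYd : ContDiff ℝ (⊤ : ℕ∞) Y)
    (hhom : ∀ (t : ℝ) x, Y (t • x) = t ^ i * Y x) (hharm : ∀ x, lap Y x = 0)
    {G G' G'' : ℝ → ℝ} (hG : ∀ s, 0 ≤ s → HasDerivAt G (G' s) s)
    (hG' : ∀ s, 0 ≤ s → HasDerivAt G' (G'' s) s) (hΦ : ∀ x, Φ x = G (‖x‖ ^ 2) * Y x)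
    (x : EuclideanSpace ℝ (Fin N)) :
    lap Φ x = (4 * ‖x‖ ^ 2 * G'' (‖x‖ ^ 2) + (2 * N + 4 * i) * G' (‖x‖ ^ 2)) * Y x := by
  have hYdiff : ∀ z, HasFDerivAt Y (fderiv ℝ Y z) z := fun z =>
    (hYd.differentiable (by simp) z).hasFDerivAt
  have hY2 : ∀ (e : EuclideanSpace ℝ (Fin N)) z, HasFDerivAt (fun z => fderiv ℝ Y z e)
      (fderiv ℝ (fun z => fderiv ℝ Y z e) z) z := fun e z =>
    (((hYd.fderiv_right (m := 1) (by norm_cast)).clm_apply contDiff_const).differentiable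
      (by simp) z).hasFDerivAt
  have hn : ∀ z : EuclideanSpace ℝ (Fin N),
      HasFDerivAt (fun z : EuclideanSpace ℝ (Fin N) => ‖z‖ ^ 2) (2 • innerSL ℝ z) z := fun z =>
    (hasStrictFDerivAt_norm_sq z).hasFDerivAt
  have hin : ∀ (z : EuclideanSpace ℝ (Fin N)) l,
      inner ℝ z (EuclideanSpace.single l (1 : ℝ)) = z l := fun z l => by
    simp [EuclideanSpace.inner_single_right]
  have hcomp : ∀ {F F' : ℝ → ℝ}, (∀ s, 0 ≤ s → HasDerivAt F (F' s) s) →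
      ∀ z : EuclideanSpace ℝ (Fin N), HasFDerivAt (fun z => F (‖z‖ ^ 2))
        (F' (‖z‖ ^ 2) • (2 • innerSL ℝ z)) z := fun hF z =>
    (hF _ (by positivity)).comp_hasFDerivAt z (hn z)
  have hfirst : ∀ l, (fun z => fderiv ℝ Φ z (EuclideanSpace.single l 1)) =
      fun z => (G (‖z‖ ^ 2) * fderiv ℝ Y z (EuclideanSpace.single l 1)
        + (2 * z l) * (G' (‖z‖ ^ 2) * Y z)) := by
    intro l
    funext z
    rw [show Φ = fun x => G (‖x‖ ^ 2) * Y x from funext hΦ,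
      ((hcomp hG z).fun_mul (hYdiff z)).fderiv]
    simp only [add_apply, smul_apply, innerSL_apply_apply, hin,
      smul_eq_mul, nsmul_eq_mul, Nat.cast_ofNat]
    ring
  have hcoord : ∀ l, HasFDerivAt (fun z : EuclideanSpace ℝ (Fin N) => 2 * z l)
      ((2 : ℝ) • (EuclideanSpace.proj l : EuclideanSpace ℝ (Fin N) →L[ℝ] ℝ)) x := fun l =>
    (EuclideanSpace.proj (𝕜 := ℝ) l).hasFDerivAt.const_mul 2
  have hsecond : ∀ l, fderiv ℝ (fun z => fderiv ℝ Φ z (EuclideanSpace.single l 1)) x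
        (EuclideanSpace.single l 1) =
      G (‖x‖ ^ 2) * fderiv ℝ (fun z => fderiv ℝ Y z (EuclideanSpace.single l 1)) x
          (EuclideanSpace.single l 1)
        + 4 * G' (‖x‖ ^ 2) * (x l * fderiv ℝ Y x (EuclideanSpace.single l 1))
        + 2 * G' (‖x‖ ^ 2) * Y x + 4 * G'' (‖x‖ ^ 2) * Y x * x l ^ 2 := by
    intro l
    rw [hfirst l, (((hcomp hG x).fun_mul (hY2 _ x)).fun_add
      ((hcoord l).fun_mul ((hcomp hG' x).fun_mul (hYdiff x)))).fderiv]
    simp only [add_apply, smul_apply, innerSL_apply_apply, hin,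
      smul_eq_mul, nsmul_eq_mul, Nat.cast_ofNat, PiLp.proj_apply, PiLp.single_apply, if_true]
    ring
  have hEuler : ∑ l, x l * fderiv ℝ Y x (EuclideanSpace.single l 1) = i * Y x := by
    rw [EuclideanSpace.sum_mul_apply_single]
    exact fderiv_apply_self_of_homogeneous (hYdiff x).differentiableAt fun t => hhom t x
  have hsq : ∑ l, x l ^ 2 = ‖x‖ ^ 2 := (EuclideanSpace.real_norm_sq_eq x).symm
  have hh := hharm x
  unfold lap at hh ⊢
  simp only [hsecond, Finset.sum_add_distrib, ← Finset.mul_sum, hh, hEuler, hsq, Finset.sum_const,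
    Finset.card_univ, Fintype.card_fin, nsmul_eq_mul]
  ring

open Polynomial in
theorem hasDerivAt_rpow_mul_eval (p : Polynomial ℝ) (b : ℝ) {s : ℝ} (hs : 0 ≤ s) :
    HasDerivAt (fun s : ℝ => (1 + s) ^ b * p.eval (1 - 2 / (1 + s)))
      (b * ((1 + s) ^ (b - 1) * p.eval (1 - 2 / (1 + s)))
        + 2 * ((1 + s) ^ (b - 2) * (derivative p).eval (1 - 2 / (1 + s)))) s := by
  have hu : 0 < 1 + s := by linarith
  have h1 : HasDerivAt (fun s : ℝ => 1 + s) 1 s := (hasDerivAt_id s).const_add 1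
  have h2 : HasDerivAt (fun s : ℝ => 1 - 2 / (1 + s)) (2 / (1 + s) ^ 2) s := by
    refine (((hasDerivAt_const s (2 : ℝ)).fun_div h1 hu.ne').const_sub 1).congr_deriv ?_
    ring
  have h3 : HasDerivAt (fun s : ℝ => p.eval (1 - 2 / (1 + s)))
      ((derivative p).eval (1 - 2 / (1 + s)) * (2 / (1 + s) ^ 2)) s :=
    HasDerivAt.comp (h₂ := fun t => p.eval t) s (p.hasDerivAt (1 - 2 / (1 + s))) h2
  have h4 : (1 + s) ^ (b - 2) = (1 + s) ^ b / (1 + s) ^ 2 := by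
    rw [Real.rpow_sub hu]; norm_num
  refine ((h1.rpow_const (p := b) (Or.inl hu.ne')).fun_mul h3).congr_deriv ?_
  rw [h4]
  ring

theorem stmt1 (N : ℕ) (hN : 3 ≤ N) (i j : ℕ) (σ : ℝ) (hσ : σ = ((N : ℝ) - 2) / 2 + i)
    -- `Y` is a harmonic polynomial, homogeneous of degree `i`
    (Y : EuclideanSpace ℝ (Fin N) → ℝ) (q : MvPolynomial (Fin N) ℝ)
    (hq : q.IsHomogeneous i) (hY : ∀ x, Y x = MvPolynomial.eval (fun l => x l) q)
    (hharm : ∀ x, lap Y x = 0)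
    -- `P` is the Jacobi polynomial `P_j^{(σ,σ)}`, given by the Rodrigues formula on `(-1,1)`
    (P : ℝ → ℝ) (hpoly : ∃ p : Polynomial ℝ, ∀ t, P t = p.eval t)
    (hP : ∀ t ∈ Set.Ioo (-1 : ℝ) 1,
      P t = ((-1 : ℝ) ^ j / (2 ^ j * (Nat.factorial j : ℝ))) * (1 - t ^ 2) ^ (-σ) *
        iteratedDeriv j (fun s : ℝ => (1 - s ^ 2) ^ (σ + (j : ℝ))) t)
    (Φ : EuclideanSpace ℝ (Fin N) → ℝ)
    (hΦ : ∀ x, Φ x = (1 + ‖x‖ ^ 2) ^ (-(((N : ℝ) - 2) / 2 + (i : ℝ))) *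
        P (1 - 2 / (1 + ‖x‖ ^ 2)) * Y x)
    (lam : ℝ)
    (hlam : lam = 1 - ((N : ℝ) * ((N : ℝ) + 2)) /
        ((((N : ℝ) + 1) + 2 * ((i : ℝ) + (j : ℝ) - 1)) ^ 2 - 1)) :
    ContDiff ℝ (⊤ : ℕ∞) Φ ∧
    ∀ x, (1 - lam) * (-(lap Φ x)) = (N : ℝ) * ((N : ℝ) + 2) * (1 + ‖x‖ ^ 2) ^ (-2 : ℝ) * Φ x := by
  obtain ⟨p, hp⟩ := hpoly
  have hYsm : ContDiff ℝ (⊤ : ℕ∞) Y := by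
    rw [show Y = _ from funext hY]; exact contDiff_eval_mvPolynomial q
  have hhom : ∀ (t : ℝ) x, Y (t • x) = t ^ i * Y x := by
    intro t x
    rw [hY, hY]
    exact MvPolynomial.IsHomogeneous.eval_smul hq t (fun l => x l)
  have hu : ∀ x : EuclideanSpace ℝ (Fin N), 0 < 1 + ‖x‖ ^ 2 := fun x => by positivity
  have hΦ' : ∀ x, Φ x = ((1 + ‖x‖ ^ 2) ^ (-σ) * p.eval (1 - 2 / (1 + ‖x‖ ^ 2))) * Y x := fun x => by
    rw [hΦ, hp, hσ]
  refine ⟨?_, fun x => ?_⟩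
  · have hb : ContDiff ℝ (⊤ : ℕ∞) (fun x : EuclideanSpace ℝ (Fin N) => 1 + ‖x‖ ^ 2) :=
      contDiff_const.add (contDiff_norm_sq ℝ)
    rw [show Φ = _ from funext hΦ']
    refine ContDiff.mul (ContDiff.mul (hb.rpow_const_of_ne fun x => (hu x).ne') ?_) hYsm
    have hpc : ContDiff ℝ (⊤ : ℕ∞) fun t => p.eval t := by
      simpa using p.contDiff_aeval (𝕜 := ℝ) _
    exact hpc.comp (contDiff_const.sub (contDiff_const.div hb fun x => (hu x).ne'))
  · have hode := jacobi_ode (p := p) (fun t ht => (hp t) ▸ hP t ht) (1 - 2 / (1 + ‖x‖ ^ 2))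
    have hlap := lap_radial_mul (Φ := Φ) hYsm hhom hharm
      (fun s hs => hasDerivAt_rpow_mul_eval p (-σ) hs)
      (fun s hs => ((hasDerivAt_rpow_mul_eval p (-σ - 1) hs).const_mul (-σ)).fun_add
        ((hasDerivAt_rpow_mul_eval (Polynomial.derivative p) (-σ - 2) hs).const_mul 2)) hΦ' x
    have hx := hu x
    rw [hlap, hΦ' x, show -σ - 1 - 1 = -σ - (2 : ℕ) by push_cast; ring,
      show -σ - 1 - 2 = -σ - (3 : ℕ) by push_cast; ring,
      show -σ - 2 - 1 = -σ - (3 : ℕ) by push_cast; ring,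
      show -σ - 2 - 2 = -σ - (4 : ℕ) by push_cast; ring,
      show -σ - 2 = -σ - (2 : ℕ) by push_cast; ring,
      show (-2 : ℝ) = -((2 : ℕ) : ℝ) by norm_num]
    simp only [Real.rpow_sub_natCast hx.ne', Real.rpow_sub_one hx.ne', Real.rpow_neg hx.le _,
      Real.rpow_natCast]
    have hN' : (3 : ℝ) ≤ N := by exact_mod_cast hN
    have hi0 : (0 : ℝ) ≤ i := by positivity
    have hj0 : (0 : ℝ) ≤ j := by positivity
    have hσj : 0 < σ + j := by rw [hσ]; linarith
    have hlam' : 1 - lam = N * (N + 2) / (4 * ((σ + j) * (σ + j + 1))) := by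
      rw [hlam, hσ]; ring_nf
    have hNσ : 2 * (N : ℝ) + 4 * i = 4 * (σ + 1) := by rw [hσ]; ring
    rw [hlam', hNσ]
    generalize (Polynomial.derivative (Polynomial.derivative p)).eval (1 - 2 / (1 + ‖x‖ ^ 2)) = p2
      at *
    generalize (Polynomial.derivative p).eval (1 - 2 / (1 + ‖x‖ ^ 2)) = p1 at *
    generalize p.eval (1 - 2 / (1 + ‖x‖ ^ 2)) = p0 at *
    generalize ((1 + ‖x‖ ^ 2) ^ σ)⁻¹ = W at *
    obtain ⟨u, hus⟩ : ∃ u, 1 + ‖x‖ ^ 2 = u := ⟨_, rfl⟩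
    have hs : ‖x‖ ^ 2 = u - 1 := by linarith
    rw [hus] at hode hx ⊢
    rw [hs]
    field_simp at hode ⊢
    push_cast
    linear_combination -(W * Y x) * hode
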